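/- arXiv:1910.14437 — 6 statements merged into one kernel-verified Lean document; each statement's English description precedes it below -/
import Mathlib

section
/- Suppose a right-angled Coxeter group W = W(M), where M is a right-angled Coxeter matrix on a finite type, acts faithfully and geometrically on the Euclidean plane EuclideanSpace ℝ (Fin 2). Then W is isomorphic to the direct product D∞ × D∞ of two copies of the infinite dihedral group. -/
noncomputable section

/-- The Euclidean plane. -/
abbrev Plane := EuclideanSpace ℝ (Fin 2)

/-- A homomorphism `ρ` from a group `G` to the isometry group of the plane is a
geometric action if it is properly discontinuous (every compact set meets only
finitely many of its translates) and cocompact (the translates of some compact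
set cover the plane). -/
def IsGeometricAction {G : Type*} [Group G] (ρ : G →* (Plane ≃ᵢ Plane)) : Prop :=
  (∀ K : Set Plane, IsCompact K → {g : G | ((ρ g) '' K ∩ K).Nonempty}.Finite) ∧
  (∃ K : Set Plane, IsCompact K ∧ (⋃ g : G, (ρ g) '' K) = Set.univ)


namespace IsometryEquiv

/-- An isometry of the plane is affine with orthogonal linear part. -/
lemma exists_linearPart (g : Plane ≃ᵢ Plane) :
    ∃ L : Plane ≃ₗᵢ[ℝ] Plane, ∀ x v, g (x + v) = g x + L v := by
  refine ⟨g.toRealAffineIsometryEquiv.linearIsometryEquiv, fun x v ↦ ?_⟩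
  have := g.toRealAffineIsometryEquiv.map_vadd x v
  simpa [add_comm] using this

end IsometryEquiv

/-- A linear isometry of the plane fixing a nonzero vector is an involution. -/
lemma LinearIsometryEquiv.apply_apply_of_apply_eq (L : Plane ≃ₗᵢ[ℝ] Plane) {u : Plane}
    (hu : u ≠ 0) (hLu : L u = u) (v : Plane) : L (L v) = v := by
  obtain ⟨a, ha⟩ : ∃ a : ℝ, u 0 = a := ⟨_, rfl⟩
  obtain ⟨b, hb⟩ : ∃ b : ℝ, u 1 = b := ⟨_, rfl⟩
  obtain ⟨w, hw0, hw1⟩ : ∃ w : Plane, w 0 = -b ∧ w 1 = a := ⟨!₂[-b, a], rfl, rfl⟩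
  obtain ⟨p, hp⟩ : ∃ p : ℝ, L w 0 = p := ⟨_, rfl⟩
  obtain ⟨q, hq⟩ : ∃ q : ℝ, L w 1 = q := ⟨_, rfl⟩
  have hn : a ^ 2 + b ^ 2 ≠ 0 := by
    intro h
    apply hu
    ext i
    fin_cases i
    · change u 0 = 0
      rw [ha]
      nlinarith [sq_nonneg a, sq_nonneg b]
    · change u 1 = 0
      rw [hb]
      nlinarith [sq_nonneg a, sq_nonneg b]
  have h1 : inner ℝ (L w) u = inner ℝ w u := by
    conv_lhs => rw [← hLu]
    exact L.inner_map_map w u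
  have h2 : inner ℝ (L w) (L w) = inner ℝ w w := L.inner_map_map w w
  simp only [PiLp.inner_apply, Fin.sum_univ_two, RCLike.inner_apply, conj_trivial, ha, hb, hp, hq,
    hw0, hw1] at h1 h2
  obtain ⟨c, hc⟩ : ∃ c : ℝ, L w = c • w := by
    refine ⟨(q * a - p * b) / (a ^ 2 + b ^ 2), ?_⟩
    ext i
    fin_cases i
    · change L w 0 = (q * a - p * b) / (a ^ 2 + b ^ 2) * w 0
      rw [hp, hw0, div_mul_eq_mul_div, eq_div_iff hn]
      linear_combination a * h1
    · change L w 1 = (q * a - p * b) / (a ^ 2 + b ^ 2) * w 1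
      rw [hq, hw1, div_mul_eq_mul_div, eq_div_iff hn]
      linear_combination b * h1
  have hcc : c * c = 1 := by
    have hpc : p = c * -b := by rw [← hp, ← hw0, hc]; rfl
    have hqc : q = c * a := by rw [← hq, ← hw1, hc]; rfl
    apply mul_right_cancel₀ hn
    rw [hpc, hqc] at h2
    linear_combination h2
  have hv : v = ((v 0 * a + v 1 * b) / (a ^ 2 + b ^ 2)) • u +
      ((v 1 * a - v 0 * b) / (a ^ 2 + b ^ 2)) • w := by
    ext i
    fin_cases i
    · change v 0 = (v 0 * a + v 1 * b) / (a ^ 2 + b ^ 2) * u 0 +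
        (v 1 * a - v 0 * b) / (a ^ 2 + b ^ 2) * w 0
      rw [ha, hw0]
      field_simp
      ring
    · change v 1 = (v 0 * a + v 1 * b) / (a ^ 2 + b ^ 2) * u 1 +
        (v 1 * a - v 0 * b) / (a ^ 2 + b ^ 2) * w 1
      rw [hb, hw1]
      field_simp
      ring
  rw [hv]
  simp only [map_add, map_smul, hLu, hc, smul_smul]
  rw [mul_assoc, hcc, mul_one]

/-- The square of a fixed-point-free isometry of the plane is a translation. -/
lemma IsometryEquiv.exists_sq_eq_translation (g : Plane ≃ᵢ Plane) (hg : ∀ x, g x ≠ x) :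
    ∃ u, ∀ x, g (g x) = x + u := by
  obtain ⟨L, hL⟩ := g.exists_linearPart
  have hg0 : ∀ x, g x = g 0 + L x := fun x ↦ by simpa using hL 0 x
  obtain ⟨u, hu, hLu⟩ : ∃ u, u ≠ 0 ∧ L u = u := by
    by_contra! h
    let D : Plane →ₗ[ℝ] Plane := L.toLinearEquiv.toLinearMap - LinearMap.id
    have hD : ∀ x, D x = L x - x := fun x ↦ rfl
    have hinj : Function.Injective D := by
      rw [← LinearMap.ker_eq_bot, LinearMap.ker_eq_bot']
      intro m hm
      by_contra hm0
      exact h m hm0 (sub_eq_zero.1 (hD m ▸ hm))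
    obtain ⟨x, hx⟩ := LinearMap.injective_iff_surjective.1 hinj (-g 0)
    apply hg x
    rw [hg0 x, ← sub_eq_zero, add_sub_assoc, ← hD, hx, add_neg_cancel]
  refine ⟨g 0 + L (g 0), fun x ↦ ?_⟩
  rw [hg0 (g x), hg0 x, map_add, L.apply_apply_of_apply_eq hu hLu]
  abel

/-- In a geometric action on the plane, elements of infinite order act without fixed points. -/
lemma IsGeometricAction.apply_ne {G : Type*} [Group G] {ρ : G →* (Plane ≃ᵢ Plane)}
    (hρ : IsGeometricAction ρ) {g : G} (hg : ¬ IsOfFinOrder g) (x : Plane) : ρ g x ≠ x := by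
  intro hx
  have hfin := hρ.1 {x} isCompact_singleton
  refine Set.infinite_of_injective_forall_mem (injective_pow_iff_not_isOfFinOrder.2 hg)
    (fun n : ℕ ↦ ?_) hfin
  refine ⟨x, ⟨x, rfl, ?_⟩, rfl⟩
  induction n with
  | zero => simp
  | succ n ih => rw [pow_succ, map_mul, IsometryEquiv.mul_apply, hx, ih]

/-- In a faithful geometric action on the plane, the square of an element of infinite order acts
as a nontrivial translation. -/
lemma IsGeometricAction.exists_sq_eq_translation {G : Type*} [Group G]
    {ρ : G →* (Plane ≃ᵢ Plane)} (hρ : IsGeometricAction ρ) (hinj : Function.Injective ρ)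
    {g : G} (hg : ¬ IsOfFinOrder g) : ∃ u ≠ 0, ∀ x, ρ (g ^ 2) x = x + u := by
  obtain ⟨u, hu⟩ := (ρ g).exists_sq_eq_translation (hρ.apply_ne hg)
  have hu' : ∀ x, ρ (g ^ 2) x = x + u := fun x ↦ by
    rw [pow_two, map_mul, IsometryEquiv.mul_apply, hu]
  refine ⟨u, ?_, hu'⟩
  rintro rfl
  refine hg (isOfFinOrder_iff_pow_eq_one.2 ⟨2, two_pos, hinj ?_⟩)
  ext1 x
  rw [hu', add_zero, map_one, IsometryEquiv.coe_one, id]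

/-- If a group acts geometrically on the plane, then a normal subgroup consisting of translations
along a fixed line has infinite index. -/
lemma IsGeometricAction.not_finite_quotient {G : Type*} [Group G] {ρ : G →* (Plane ≃ᵢ Plane)}
    (hρ : IsGeometricAction ρ) (T : Subgroup G) [T.Normal] (u : Plane)
    (hT : ∀ g ∈ T, ∃ c : ℝ, ∀ x, ρ g x = x + c • u) : ¬ Finite (G ⧸ T) := by
  intro hfin
  obtain ⟨K, hK, hcover⟩ := hρ.2
  obtain ⟨w, hw, hwu⟩ : ∃ w : Plane, w ≠ 0 ∧ inner ℝ w u = 0 := by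
    by_cases hu : u = 0
    · obtain ⟨w, hw⟩ := exists_ne (0 : Plane)
      exact ⟨w, hw, by simp [hu]⟩
    · refine ⟨!₂[-u 1, u 0], fun h ↦ hu ?_, ?_⟩
      · have h0 := congrArg (fun v : Plane ↦ v 0) h
        have h1 := congrArg (fun v : Plane ↦ v 1) h
        ext i
        fin_cases i <;> simp_all
      · simp [PiLp.inner_apply, Fin.sum_univ_two]
        ring
  let S : Set ℝ := ⋃ q : G ⧸ T, (fun x ↦ inner ℝ w x) '' (ρ q.out '' K)
  have hS : IsCompact S := isCompact_iUnion fun q ↦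
    (hK.image (ρ q.out).continuous).image (by fun_prop)
  obtain ⟨C, hC⟩ := hS.isBounded.exists_norm_le
  have hall : ∀ x : Plane, |inner ℝ w x| ≤ C := by
    intro x
    have hx : x ∈ ⋃ g : G, (ρ g) '' K := hcover ▸ Set.mem_univ x
    obtain ⟨g, y, hy, rfl⟩ := Set.mem_iUnion.1 hx
    have hmem : g * ((g : G ⧸ T).out)⁻¹ ∈ T := by
      rw [Subgroup.Normal.mem_comm_iff inferInstance, ← QuotientGroup.eq]
      simp
    obtain ⟨c, hc⟩ := hT _ hmem
    have hg : ρ g y = ρ (g : G ⧸ T).out y + c • u := by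
      rw [← hc, ← IsometryEquiv.mul_apply, ← map_mul, inv_mul_cancel_right]
    rw [hg, inner_add_right, inner_smul_right, hwu, mul_zero, add_zero]
    exact hC _ (Set.mem_iUnion.2 ⟨(g : G ⧸ T), _, ⟨y, hy, rfl⟩, rfl⟩)
  have hpos : 0 < inner ℝ w w := real_inner_self_pos.2 hw
  have := hall (((C + 1) / inner ℝ w w) • w)
  rw [inner_smul_right, div_mul_cancel₀ _ hpos.ne'] at this
  linarith [le_abs_self (C + 1)]

namespace CoxeterMatrix

variable {B : Type*} {M : CoxeterMatrix B}

lemma apply_comm (M : CoxeterMatrix B) (i j : B) : M i j = M j i := M.symmetric i j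

lemma ne_of_apply_eq_zero {i j : B} (h : M i j = 0) : i ≠ j := by
  rintro rfl
  simp at h

local notation "s" => CoxeterSystem.simple (CoxeterMatrix.toCoxeterSystem M)

/-- In the right-angled case, a family of involutions satisfying the commutation relations extends
to the Coxeter group. -/
lemma exists_hom_of_rightAngled (hRA : ∀ i j : B, i ≠ j → M i j = 2 ∨ M i j = 0)
    {G : Type*} [Group G] (f : B → G) (hf : ∀ i, f i * f i = 1)
    (hcomm : ∀ i j, M i j = 2 → Commute (f i) (f j)) :
    ∃ φ : M.Group →* G, ∀ i, φ (s i) = f i := by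
  have hlift : M.IsLiftable f := by
    intro i j
    by_cases hij : i = j
    · subst hij
      rw [hf, one_pow]
    · rcases hRA i j hij with h | h
      · rw [h, (hcomm i j h).mul_pow, pow_two, pow_two, hf, hf, one_mul]
      · rw [h, pow_zero]
  exact ⟨M.toCoxeterSystem.lift ⟨f, hlift⟩, M.toCoxeterSystem.lift_apply_simple hlift⟩

lemma simple_ne_one (hRA : ∀ i j : B, i ≠ j → M i j = 2 ∨ M i j = 0) (i : B) : s i ≠ 1 := by
  obtain ⟨φ, hφ⟩ := exists_hom_of_rightAngled hRA (fun _ ↦ Multiplicative.ofAdd (1 : ZMod 2))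
    (fun _ ↦ by decide) (fun _ _ _ ↦ Commute.refl _)
  intro h
  have := hφ i
  rw [h, map_one] at this
  exact absurd this (by decide)

open Classical in
lemma not_isOfFinOrder_simple_mul_simple (hRA : ∀ i j : B, i ≠ j → M i j = 2 ∨ M i j = 0)
    {i j : B} (hij : M i j = 0) : ¬ IsOfFinOrder (s i * s j) := by
  have hne := ne_of_apply_eq_zero hij
  obtain ⟨φ, hφ⟩ := exists_hom_of_rightAngled hRA
    (fun k ↦ if k = i then DihedralGroup.sr (0 : ZMod 0) else
      if k = j then DihedralGroup.sr 1 else 1)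
    (fun k ↦ by split_ifs <;> simp)
    (fun k l hkl ↦ by
      have hji : M j i = 0 := M.apply_comm i j ▸ hij
      split_ifs <;> simp_all)
  intro h
  have := φ.isOfFinOrder h
  rw [map_mul, hφ, hφ, if_pos rfl, if_neg hne.symm, if_pos rfl, DihedralGroup.sr_mul_sr, sub_zero,
    ← orderOf_pos_iff, DihedralGroup.orderOf_r_one] at this
  exact this.false

lemma commute_simple {i j : B} (hij : M i j = 2) : Commute (s i) (s j) := by
  have h := M.toCoxeterSystem.simple_mul_simple_pow i j
  rw [hij, pow_two, mul_eq_one_iff_eq_inv, mul_inv_rev, CoxeterSystem.inv_simple,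
    CoxeterSystem.inv_simple] at h
  exact h

open Classical in
/-- If two generators both fail to commute with a third one, the squares of the corresponding
products do not commute. -/
lemma not_commute_sq (hRA : ∀ i j : B, i ≠ j → M i j = 2 ∨ M i j = 0)
    {p i j : B} (hpi : M p i = 0) (hpj : M p j = 0) (hij : i ≠ j) :
    ¬ Commute ((s p * s i) ^ 2) ((s p * s j) ^ 2) := by
  have hip := M.apply_comm p i ▸ hpi
  have hjp := M.apply_comm p j ▸ hpj
  have hi := ne_of_apply_eq_zero hip
  have hj := ne_of_apply_eq_zero hjp
  obtain ⟨φ, hφ⟩ := exists_hom_of_rightAngled hRA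
    (fun k ↦ if k = p then Equiv.swap (1 : Fin 4) 2 else
      if k = i then Equiv.swap 0 1 else if k = j then Equiv.swap 2 3 else 1)
    (fun k ↦ by split_ifs <;> simp)
    (fun k l hkl ↦ by
      have hc : Commute (Equiv.swap (0 : Fin 4) 1) (Equiv.swap 2 3) := by
        unfold Commute SemiconjBy; decide
      split_ifs <;> simp_all [hc.symm])
  intro h
  have := h.map φ
  simp only [map_mul, map_pow, hφ, if_pos, if_neg hi, if_neg hj, if_neg hij.symm] at this
  revert this
  unfold Commute SemiconjBy
  decide

/-- A quotient of a Coxeter group of finite rank in which all generators commute is finite. -/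
lemma finite_quotient [Finite B] (T : Subgroup M.Group) [T.Normal]
    (hT : ∀ i j, (s i * s j) ^ 2 ∈ T) : Finite (M.Group ⧸ T) := by
  have hgen : ∀ i j, Commute (s i : M.Group ⧸ T) (s j : M.Group ⧸ T) := by
    intro i j
    have h : ((s i * s j) ^ 2 : M.Group ⧸ T) = 1 := (QuotientGroup.eq_one_iff _).2 (hT i j)
    have hinv : ∀ k, (s k : M.Group ⧸ T)⁻¹ = s k := fun k ↦ by
      rw [← QuotientGroup.mk_inv, CoxeterSystem.inv_simple]
    rw [pow_two, mul_eq_one_iff_eq_inv, mul_inv_rev, hinv, hinv] at h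
    exact h
  have hcomm : ∀ w w' : M.Group, Commute (w : M.Group ⧸ T) (w' : M.Group ⧸ T) := by
    intro w w'
    refine M.toCoxeterSystem.simple_induction
      (p := fun w ↦ Commute (w : M.Group ⧸ T) (w' : M.Group ⧸ T)) w (fun i ↦ ?_)
      (Commute.one_left _) (fun _ _ ↦ Commute.mul_left)
    exact M.toCoxeterSystem.simple_induction
      (p := fun w' ↦ Commute (s i : M.Group ⧸ T) (w' : M.Group ⧸ T)) w' (fun j ↦ hgen i j)
      (Commute.one_right _) (fun _ _ ↦ Commute.mul_right)
  have hsq : ∀ w : M.Group, (w : M.Group ⧸ T) ^ 2 = 1 := by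
    intro w
    refine M.toCoxeterSystem.simple_induction (p := fun w ↦ (w : M.Group ⧸ T) ^ 2 = 1) w
      (fun i ↦ ?_) (one_pow 2) (fun w w' h h' ↦ ?_)
    · rw [← QuotientGroup.mk_pow, CoxeterSystem.simple_sq, QuotientGroup.mk_one]
    · rw [QuotientGroup.mk_mul, (hcomm w w').mul_pow, h, h', one_mul]
  have : Group.FG M.Group := Group.fg_iff.2
    ⟨_, M.toCoxeterSystem.subgroup_closure_range_simple, Set.finite_range _⟩
  let _ : CommGroup (M.Group ⧸ T) :=
    { (inferInstance : Group (M.Group ⧸ T)) with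
      mul_comm := by
        rintro ⟨w⟩ ⟨w'⟩
        exact hcomm w w' }
  have : Group.FG (M.Group ⧸ T) := QuotientGroup.fg T
  refine CommGroup.finite_of_fg_isMulTorsion (G := M.Group ⧸ T) ?_
  rintro ⟨w⟩
  exact isOfFinOrder_iff_pow_eq_one.2 ⟨2, two_pos, hsq w⟩

/-- A cyclic subgroup is normal if each generator centralizes or inverts it. -/
lemma zpowers_normal (t : M.Group)
    (ht : ∀ i, s i * t * (s i)⁻¹ = t ∨ s i * t * (s i)⁻¹ = t⁻¹) :
    (Subgroup.zpowers t).Normal := by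
  refine ⟨fun n hn w ↦ ?_⟩
  revert n
  refine M.toCoxeterSystem.simple_induction
    (p := fun w ↦ ∀ n ∈ Subgroup.zpowers t, w * n * w⁻¹ ∈ Subgroup.zpowers t) w
    (fun i ↦ ?_) (by simp) (fun w w' h h' n hn ↦ ?_)
  · rintro _ ⟨k, rfl⟩
    dsimp only
    rw [← conj_zpow]
    refine Subgroup.zpow_mem _ ?_ k
    rcases ht i with h | h <;> rw [h]
    · exact Subgroup.mem_zpowers t
    · exact Subgroup.inv_mem _ (Subgroup.mem_zpowers t)
  · simpa [mul_assoc] using h _ (h' n hn)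

end CoxeterMatrix

/-- Two involutions define a homomorphism from the infinite dihedral group. -/
lemma DihedralGroup.exists_hom_of_involutions {G : Type*} [Group G] (x y : G) (hx : x * x = 1)
    (hy : y * y = 1) : ∃ φ : DihedralGroup 0 →* G, φ (.sr 0) = x ∧ φ (.sr 1) = y ∧
      ∀ z, Commute x z → Commute y z → ∀ d, Commute (φ d) z := by
  have hinv : x * (x * y) * x⁻¹ = (x * y)⁻¹ := by
    rw [← mul_assoc, hx, one_mul, mul_inv_rev, inv_eq_of_mul_eq_one_right hy]
  have hconj : ∀ n : ℤ, x * (x * y) ^ n = (x * y) ^ (-n) * x := by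
    intro n
    rw [← mul_inv_eq_iff_eq_mul, ← conj_zpow, hinv, inv_zpow, zpow_neg]
  let e : ZMod 0 →+* ℤ := RingHom.id ℤ
  let f : DihedralGroup 0 → G
    | .r n => (x * y) ^ e n
    | .sr n => x * (x * y) ^ e n
  have hr : ∀ n, f (.r n) = (x * y) ^ e n := fun _ ↦ rfl
  have hsr : ∀ n, f (.sr n) = x * (x * y) ^ e n := fun _ ↦ rfl
  have hf : ∀ c d, f (c * d) = f c * f d := by
    rintro (m | m) (n | n)
    · rw [r_mul_r, hr, hr, hr, map_add, zpow_add]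
    · rw [r_mul_sr, hr, hsr, hsr, hconj, hconj, ← mul_assoc, ← zpow_add, map_sub, neg_sub,
        sub_eq_add_neg]
    · rw [sr_mul_r, hsr, hr, hsr, map_add, zpow_add, mul_assoc]
    · rw [sr_mul_sr, hsr, hr, hsr, hconj (e m), mul_assoc, ← mul_assoc x x, hx, one_mul,
        ← zpow_add, map_sub, sub_eq_neg_add]
  refine ⟨MonoidHom.mk' f hf, ?_, ?_, ?_⟩
  · rw [MonoidHom.mk'_apply, hsr, map_zero, zpow_zero, mul_one]
  · rw [MonoidHom.mk'_apply, hsr, map_one, zpow_one, ← mul_assoc, hx, one_mul]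
  · rintro z hxz hyz (n | n)
    · exact (hxz.mul_left hyz).zpow_left (e n)
    · exact hxz.mul_left ((hxz.mul_left hyz).zpow_left (e n))

/-- The infinite dihedral group is generated by the two reflections `sr 0` and `sr 1`. -/
lemma DihedralGroup.mem_of_sr_mem (H : Subgroup (DihedralGroup 0)) (h0 : .sr 0 ∈ H)
    (h1 : .sr 1 ∈ H) (d : DihedralGroup 0) : d ∈ H := by
  have hr : ∀ n : ZMod 0, .r n ∈ H := fun n ↦ by
    have := H.zpow_mem (H.mul_mem h0 h1) (RingHom.id ℤ n)
    rw [sr_mul_sr, sub_zero, r_one_zpow] at this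
    exact this
  rcases d with n | n
  · exact hr n
  · simpa using H.mul_mem h0 (hr n)

namespace CoxeterMatrix

variable {B : Type*} {M : CoxeterMatrix B}

local notation "s" => CoxeterSystem.simple (CoxeterMatrix.toCoxeterSystem M)

open Classical in
/-- The Coxeter group of two commuting pairs of non-commuting generators is `D∞ × D∞`. -/
lemma nonempty_mulEquiv_dihedral_prod (hRA : ∀ i j : B, i ≠ j → M i j = 2 ∨ M i j = 0)
    {a a' b b' : B} (hB : ∀ c, c = a ∨ c = a' ∨ c = b ∨ c = b') (ha : M a a' = 0)
    (hb : M b b' = 0) (hab : M a b = 2) (hab' : M a b' = 2) (ha₁b : M a' b = 2)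
    (ha₁b' : M a' b' = 2) : Nonempty (M.Group ≃* (DihedralGroup 0 × DihedralGroup 0)) := by
  have hne : ∀ {i j}, M i j = 2 → i ≠ j := by
    rintro i _ h rfl
    simp at h
  have na := (ne_of_apply_eq_zero ha).symm
  have nb := (ne_of_apply_eq_zero hb).symm
  have nab := (hne hab).symm
  have nab' := (hne hab').symm
  have na₁b := (hne ha₁b).symm
  have na₁b' := (hne ha₁b').symm
  let f : B → DihedralGroup 0 × DihedralGroup 0 := fun k ↦
    if k = a then (.sr 0, 1) else if k = a' then (.sr 1, 1) else
      if k = b then (1, .sr 0) else (1, .sr 1)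
  have fa : f a = (.sr 0, 1) := by simp [f]
  have fa' : f a' = (.sr 1, 1) := by simp [f, na]
  have fb : f b = (1, .sr 0) := by simp [f, nab, na₁b]
  have fb' : f b' = (1, .sr 1) := by simp [f, nab', na₁b', nb]
  have hc : ∀ x y : DihedralGroup 0, Commute (x, (1 : DihedralGroup 0))
      ((1 : DihedralGroup 0), y) := MonoidHom.commute_inl_inr
  have ha2 := M.apply_comm a a' ▸ ha
  have hb2 := M.apply_comm b b' ▸ hb
  obtain ⟨φ, hφ⟩ := exists_hom_of_rightAngled hRA f
    (fun k ↦ by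
      rcases hB k with rfl | rfl | rfl | rfl
      · simp [fa]
      · simp [fa']
      · simp [fb]
      · simp [fb'])
    (fun k l hkl ↦ by
      rcases hB k with rfl | rfl | rfl | rfl <;> rcases hB l with rfl | rfl | rfl | rfl <;>
      first
      | exact Commute.refl _
      | omega
      | (simp only [fa, fa', fb, fb']; exact hc _ _)
      | (simp only [fa, fa', fb, fb']; exact (hc _ _).symm))
  have hs := fun i ↦ M.toCoxeterSystem.simple_mul_simple_self i
  obtain ⟨α, αa, αa', hα⟩ :=
    DihedralGroup.exists_hom_of_involutions (s a) (s a') (hs a) (hs a')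
  obtain ⟨β, βb, βb', hβ⟩ :=
    DihedralGroup.exists_hom_of_involutions (s b) (s b') (hs b) (hs b')
  have hcomm : ∀ m n, Commute (α m) (β n) := fun m n ↦
    hα _ (hβ _ (commute_simple hab).symm (commute_simple hab').symm n).symm
      (hβ _ (commute_simple ha₁b).symm (commute_simple ha₁b').symm n).symm m
  let ψ := α.noncommCoprod β hcomm
  have hψφ : ψ.comp φ = MonoidHom.id _ := by
    refine M.toCoxeterSystem.ext_simple fun i ↦ ?_
    rw [MonoidHom.comp_apply, hφ]
    rcases hB i with rfl | rfl | rfl | rfl <;> simp [ψ, *]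
  refine ⟨MulEquiv.ofBijective φ ⟨Function.LeftInverse.injective
    (g := ψ) fun w ↦ DFunLike.congr_fun hψφ w,
    fun d ↦ ?_⟩⟩
  have h1 : ∀ x : DihedralGroup 0, (x, (1 : DihedralGroup 0)) ∈ φ.range :=
    DihedralGroup.mem_of_sr_mem (φ.range.comap (MonoidHom.inl (DihedralGroup 0) (DihedralGroup 0)))
      ⟨s a, (hφ a).trans fa⟩ ⟨s a', (hφ a').trans fa'⟩
  have h2 : ∀ x : DihedralGroup 0, ((1 : DihedralGroup 0), x) ∈ φ.range :=
    DihedralGroup.mem_of_sr_mem (φ.range.comap (MonoidHom.inr (DihedralGroup 0) (DihedralGroup 0)))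
      ⟨s b, (hφ b).trans fb⟩ ⟨s b', (hφ b').trans fb'⟩
  have : d ∈ φ.range := by simpa using φ.range.mul_mem (h1 d.1) (h2 d.2)
  exact this

end CoxeterMatrix

section Translations

variable {G : Type*} [Group G] {ρ : G →* (Plane ≃ᵢ Plane)} {t : G} {u : Plane}

lemma inv_apply_eq_add_neg (ht : ∀ x, ρ t x = x + u) (x : Plane) : ρ t⁻¹ x = x + -u := by
  have h := ht (x + -u)
  rw [neg_add_cancel_right] at h
  rw [← h, ← IsometryEquiv.mul_apply, ← map_mul, inv_mul_cancel, map_one]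
  simp [h]

/-- Integer powers of a translation are translations in the same direction. -/
lemma exists_smul_of_mem_zpowers (ht : ∀ x, ρ t x = x + u) :
    ∀ g ∈ Subgroup.zpowers t, ∃ c : ℝ, ∀ x, ρ g x = x + c • u := by
  intro g hg
  rw [Subgroup.zpowers_eq_closure] at hg
  induction hg using Subgroup.closure_induction with
  | mem g hg =>
    rw [Set.mem_singleton_iff.1 hg]
    exact ⟨1, by simpa using ht⟩
  | one => exact ⟨0, by simp⟩
  | mul g h _ _ ihg ihh =>
    obtain ⟨c, hc⟩ := ihg
    obtain ⟨d, hd⟩ := ihh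
    refine ⟨d + c, fun x ↦ ?_⟩
    rw [map_mul, IsometryEquiv.mul_apply, hd, hc, add_smul, add_assoc]
  | inv g _ ih =>
    obtain ⟨c, hc⟩ := ih
    exact ⟨-c, fun x ↦ by rw [inv_apply_eq_add_neg hc, neg_smul]⟩

/-- Conjugating a translation applies the linear part to the translation vector. -/
lemma linearPart_apply_of_conj (ht : ∀ x, ρ t x = x + u) {g t' : G} {u' : Plane}
    (ht' : ∀ x, ρ t' x = x + u') (hg : g * t * g⁻¹ = t') {L : Plane ≃ₗᵢ[ℝ] Plane}
    (hL : ∀ x v, ρ g (x + v) = ρ g x + L v) : L u = u' := by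
  have h := hL 0 u
  rw [← ht, ← IsometryEquiv.mul_apply, ← map_mul, mul_inv_eq_iff_eq_mul.1 hg, map_mul,
    IsometryEquiv.mul_apply, ht'] at h
  exact (add_left_cancel h).symm

/-- Elements acting as translations commute in a faithful action. -/
lemma commute_of_translations (hinj : Function.Injective ρ) (ht : ∀ x, ρ t x = x + u) {t' : G}
    {u' : Plane} (ht' : ∀ x, ρ t' x = x + u') : Commute t t' := by
  apply hinj
  ext1 x
  rw [map_mul, map_mul, IsometryEquiv.mul_apply, IsometryEquiv.mul_apply, ht, ht', ht, ht',
    add_right_comm]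

/-- In a faithful action, an involution commuting with translations in two independent
directions is trivial. -/
lemma eq_one_of_conj_eq (hinj : Function.Injective ρ) (ht : ∀ x, ρ t x = x + u) {t' : G}
    {u' : Plane} (ht' : ∀ x, ρ t' x = x + u') (hli : LinearIndependent ℝ ![u, u']) {g : G}
    (hg : g * g = 1) (hgt : g * t * g⁻¹ = t) (hgt' : g * t' * g⁻¹ = t') : g = 1 := by
  obtain ⟨L, hL⟩ := (ρ g).exists_linearPart
  have hLu := linearPart_apply_of_conj ht ht hgt hL
  have hLu' := linearPart_apply_of_conj ht' ht' hgt' hL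
  have hspan := hli.span_eq_top_of_card_eq_finrank (by simp)
  have hid : ∀ v, L v = v := by
    have : L.toLinearEquiv.toLinearMap = LinearMap.id := LinearMap.ext_on_range hspan fun i ↦ by
      fin_cases i
      · exact hLu
      · exact hLu'
    exact fun v ↦ DFunLike.congr_fun this v
  have htr : ∀ x, ρ g x = x + ρ g 0 := fun x ↦ by
    have := hL 0 x
    rw [zero_add, hid] at this
    rw [this, add_comm]
  have h0 : ρ g 0 + ρ g 0 = 0 := by
    rw [← htr, ← IsometryEquiv.mul_apply, ← map_mul, hg, map_one, IsometryEquiv.coe_one, id]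
  have h0' : ρ g 0 = 0 := by
    rw [← two_smul ℝ] at h0
    exact (smul_eq_zero.1 h0).resolve_left two_ne_zero
  apply hinj
  ext1 x
  rw [htr, h0', add_zero, map_one, IsometryEquiv.coe_one, id]

/-- Two nontrivial translations, each inverted by an element centralizing the other, are
linearly independent. -/
lemma linearIndependent_of_conj (ht : ∀ x, ρ t x = x + u) {t' : G}
    {u' : Plane} (ht' : ∀ x, ρ t' x = x + u') (hu : u ≠ 0) (hu' : u' ≠ 0) {g : G}
    (hgt : g * t * g⁻¹ = t⁻¹) (hgt' : g * t' * g⁻¹ = t') : LinearIndependent ℝ ![u, u'] := by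
  obtain ⟨L, hL⟩ := (ρ g).exists_linearPart
  have hLu := linearPart_apply_of_conj ht (inv_apply_eq_add_neg ht) hgt hL
  have hLu' := linearPart_apply_of_conj ht' ht' hgt' hL
  rw [LinearIndependent.pair_iff' hu]
  intro c hc
  apply hu'
  rw [← hc, map_smul, hLu, smul_neg] at hLu'
  rw [eq_comm, ← sub_eq_zero, sub_neg_eq_add, ← two_smul ℝ, hc] at hLu'
  exact (smul_eq_zero.1 hLu').resolve_left two_ne_zero

end Translations

/-- The first of two involutions inverts their squared product. -/
lemma conj_mul_sq_left {G : Type*} [Group G] {x y : G} (hx : x * x = 1) (hy : y * y = 1) :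
    x * (x * y) ^ 2 * x⁻¹ = ((x * y) ^ 2)⁻¹ := by
  rw [← conj_pow, ← inv_pow, mul_inv_rev, inv_eq_of_mul_eq_one_right hy, ← mul_assoc, hx, one_mul,
    inv_eq_of_mul_eq_one_right hx]

/-- The second of two involutions inverts their squared product. -/
lemma conj_mul_sq_right {G : Type*} [Group G] {x y : G} (hx : x * x = 1) (hy : y * y = 1) :
    y * (x * y) ^ 2 * y⁻¹ = ((x * y) ^ 2)⁻¹ := by
  rw [← conj_pow, ← inv_pow, mul_inv_rev, inv_eq_of_mul_eq_one_right hy,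
    inv_eq_of_mul_eq_one_right hx, mul_assoc y, mul_assoc x, hy, mul_one]

lemma Commute.conj_mul_sq {G : Type*} [Group G] {x y z : G} (hx : Commute z x)
    (hy : Commute z y) : z * (x * y) ^ 2 * z⁻¹ = (x * y) ^ 2 := by
  rw [((hx.mul_right hy).pow_right 2).eq, mul_inv_cancel_right]

namespace IsGeometricAction

variable {B : Type*} {M : CoxeterMatrix B} {ρ : M.Group →* (Plane ≃ᵢ Plane)}

local notation "s" => CoxeterSystem.simple (CoxeterMatrix.toCoxeterSystem M)

/-- Each generator fails to commute with at most one other generator. -/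
lemma eq_of_apply_eq_zero (hρ : IsGeometricAction ρ) (hinj : Function.Injective ρ)
    (hRA : ∀ i j : B, i ≠ j → M i j = 2 ∨ M i j = 0) {p i j : B} (hpi : M p i = 0)
    (hpj : M p j = 0) : i = j := by
  by_contra hij
  obtain ⟨u, -, hu⟩ := hρ.exists_sq_eq_translation hinj
    (CoxeterMatrix.not_isOfFinOrder_simple_mul_simple hRA hpi)
  obtain ⟨v, -, hv⟩ := hρ.exists_sq_eq_translation hinj
    (CoxeterMatrix.not_isOfFinOrder_simple_mul_simple hRA hpj)
  exact CoxeterMatrix.not_commute_sq hRA hpi hpj hij (commute_of_translations hinj hu hv)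

/-- Some pair of generators does not commute. -/
lemma exists_apply_eq_zero [Finite B] (hρ : IsGeometricAction ρ)
    (hRA : ∀ i j : B, i ≠ j → M i j = 2 ∨ M i j = 0) : ∃ a a', M a a' = 0 := by
  by_contra! h
  refine hρ.not_finite_quotient ⊥ 0 (fun g hg ↦ ⟨0, fun x ↦ ?_⟩)
    (CoxeterMatrix.finite_quotient ⊥ fun i j ↦ ?_)
  · rw [Subgroup.mem_bot.1 hg, map_one, IsometryEquiv.coe_one, id, smul_zero, add_zero]
  · rw [Subgroup.mem_bot]
    by_cases hij : i = j
    · rw [hij, CoxeterSystem.simple_mul_simple_self, one_pow]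
    · rw [← (hRA i j hij).resolve_right (h i j), CoxeterSystem.simple_mul_simple_pow]

/-- There is a non-commuting pair of generators other than a given one. -/
lemma exists_other_apply_eq_zero [Finite B] (hρ : IsGeometricAction ρ)
    (hinj : Function.Injective ρ) (hRA : ∀ i j : B, i ≠ j → M i j = 2 ∨ M i j = 0) {a a' : B}
    (ha : M a a' = 0) : ∃ b b', M b b' = 0 ∧ b ≠ a ∧ b ≠ a' ∧ b' ≠ a ∧ b' ≠ a' := by
  by_contra! hno
  have ha' := M.apply_comm a a' ▸ ha
  have hpair : ∀ i j, M i j = 0 → (i = a ∧ j = a') ∨ (i = a' ∧ j = a) := by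
    intro i j hij
    by_cases hia : i = a
    · subst hia
      exact .inl ⟨rfl, hρ.eq_of_apply_eq_zero hinj hRA hij ha⟩
    by_cases hia' : i = a'
    · subst hia'
      exact .inr ⟨rfl, hρ.eq_of_apply_eq_zero hinj hRA hij ha'⟩
    have hji := M.apply_comm i j ▸ hij
    by_cases hja : j = a
    · subst hja
      exact absurd (hρ.eq_of_apply_eq_zero hinj hRA hji ha) hia'
    · have hja' := hno i j hij hia hia' hja
      subst hja'
      exact absurd (hρ.eq_of_apply_eq_zero hinj hRA hji ha') hia
  obtain ⟨u, -, hu⟩ := hρ.exists_sq_eq_translation hinj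
    (CoxeterMatrix.not_isOfFinOrder_simple_mul_simple hRA ha)
  have hs := fun i ↦ M.toCoxeterSystem.simple_mul_simple_self i
  have : (Subgroup.zpowers ((s a * s a') ^ 2)).Normal := by
    refine CoxeterMatrix.zpowers_normal _ fun i ↦ ?_
    by_cases hia : i = a
    · exact .inr (hia ▸ conj_mul_sq_left (hs i) (hs a'))
    by_cases hia' : i = a'
    · exact .inr (hia' ▸ conj_mul_sq_right (hs a) (hs i))
    refine .inl (Commute.conj_mul_sq (CoxeterMatrix.commute_simple ?_)
      (CoxeterMatrix.commute_simple ?_))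
    · exact (hRA i a hia).resolve_right fun h ↦ by grind
    · exact (hRA i a' hia').resolve_right fun h ↦ by grind
  refine hρ.not_finite_quotient _ u (exists_smul_of_mem_zpowers hu)
    (CoxeterMatrix.finite_quotient _ fun i j ↦ ?_)
  by_cases hij : i = j
  · rw [hij, hs, one_pow]
    exact one_mem _
  rcases hRA i j hij with h | h
  · rw [← h, CoxeterSystem.simple_mul_simple_pow]
    exact one_mem _
  rcases hpair i j h with ⟨rfl, rfl⟩ | ⟨rfl, rfl⟩
  · exact Subgroup.mem_zpowers _
  · refine inv_mem_iff.1 ?_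
    rw [← inv_pow, mul_inv_rev, CoxeterSystem.inv_simple, CoxeterSystem.inv_simple]
    exact Subgroup.mem_zpowers _

end IsGeometricAction

/-- If a right-angled Coxeter group (on a finite type) acts faithfully and
geometrically on the Euclidean plane, it is isomorphic to `D∞ × D∞`. -/
theorem racg_acting_on_plane_iso_dinf_prod_dinf
    {B : Type*} [Fintype B] (M : CoxeterMatrix B)
    (hRA : ∀ i j : B, i ≠ j → M i j = 2 ∨ M i j = 0)
    (ρ : M.Group →* (Plane ≃ᵢ Plane))
    (hfaithful : Function.Injective ρ)
    (hgeometric : IsGeometricAction ρ) :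
    Nonempty (M.Group ≃* (DihedralGroup 0 × DihedralGroup 0)) := by
  obtain ⟨a, a', ha⟩ := hgeometric.exists_apply_eq_zero hRA
  obtain ⟨b, b', hb, hba, hba', hb₁a, hb₁a'⟩ :=
    hgeometric.exists_other_apply_eq_zero hfaithful hRA ha
  have huniq : ∀ {i j k}, M i j = 0 → k ≠ i → k ≠ j → M k i = 2 ∧ M k j = 2 := by
    intro i j k hij hki hkj
    have hji := M.apply_comm i j ▸ hij
    refine ⟨(hRA k i hki).resolve_right fun h ↦ hkj ?_, (hRA k j hkj).resolve_right fun h ↦ hki ?_⟩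
    · exact hgeometric.eq_of_apply_eq_zero hfaithful hRA (M.apply_comm k i ▸ h) hij
    · exact hgeometric.eq_of_apply_eq_zero hfaithful hRA (M.apply_comm k j ▸ h) hji
  obtain ⟨hab, hab'⟩ := huniq hb hba.symm hb₁a.symm
  obtain ⟨ha₁b, ha₁b'⟩ := huniq hb hba'.symm hb₁a'.symm
  refine CoxeterMatrix.nonempty_mulEquiv_dihedral_prod hRA (fun c ↦ ?_) ha hb hab hab' ha₁b ha₁b'
  by_contra! hc
  obtain ⟨hca, hca', hcb, hcb'⟩ := hc
  obtain ⟨u, hu0, hu⟩ := hgeometric.exists_sq_eq_translation hfaithful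
    (CoxeterMatrix.not_isOfFinOrder_simple_mul_simple hRA ha)
  obtain ⟨v, hv0, hv⟩ := hgeometric.exists_sq_eq_translation hfaithful
    (CoxeterMatrix.not_isOfFinOrder_simple_mul_simple hRA hb)
  have hs := fun i ↦ M.toCoxeterSystem.simple_mul_simple_self i
  have hcomm : ∀ {i j}, M i j = 2 → _ := CoxeterMatrix.commute_simple (M := M)
  have hli := linearIndependent_of_conj hu hv hu0 hv0 (conj_mul_sq_left (hs a) (hs a'))
    (Commute.conj_mul_sq (hcomm hab) (hcomm hab'))
  obtain ⟨hMca, hMca'⟩ := huniq ha hca hca'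
  obtain ⟨hMcb, hMcb'⟩ := huniq hb hcb hcb'
  exact CoxeterMatrix.simple_ne_one hRA c (eq_one_of_conj_eq hfaithful hu hv hli (hs c)
    (Commute.conj_mul_sq (hcomm hMca) (hcomm hMca'))
    (Commute.conj_mul_sq (hcomm hMcb) (hcomm hMcb')))
end
end

section
/- Let f be an isometry of the Euclidean plane EuclideanSpace ℝ (Fin 2) with f ∘ f = id and f ≠ id (i.e., f has order 2 in the isometry group). Then there exists a nonempty proper affine subspace s of the plane (so s is either a single point or a line) such that f equals the Euclidean reflection across s. In other words, every order-2 isometry of the plane is either a reflection across a line or a point reflection at a point. -/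
noncomputable section

/-- The reflection across a nonempty affine subspace of the plane
(junk value `id` if the subspace is empty). -/
noncomputable def reflAcross (s : AffineSubspace ℝ Plane) : Plane → Plane :=
  letI := Classical.dec (s : Set Plane).Nonempty
  if h : (s : Set Plane).Nonempty then
    haveI : Nonempty s := h.to_subtype
    EuclideanGeometry.reflection s
  else id

section

variable {V P : Type*} [NormedAddCommGroup V] [InnerProductSpace ℝ V] [MetricSpace P]
  [NormedAddTorsor V P]

/-- An involutive isometry of a Euclidean space, as an affine isometry equivalence
(by the Mazur–Ulam theorem). -/
def Isometry.toAffineIsometryEquivOfInvolutive (f : P → P) (hf : Isometry f)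
    (hinv : Function.Involutive f) : P ≃ᵃⁱ[ℝ] P :=
  (IsometryEquiv.mk hinv.toPerm hf).toRealAffineIsometryEquiv

/-- The affine subspace of fixed points of an affine map. -/
def AffineMap.fixedSubspace (g : P →ᵃ[ℝ] P) : AffineSubspace ℝ P where
  carrier := {x | g x = x}
  smul_vsub_vadd_mem' c p₁ p₂ p₃ h₁ h₂ h₃ := by
    simp only [Set.mem_ofPred_eq] at *
    rw [g.map_vadd, map_smul, g.linearMap_vsub, h₁, h₂, h₃]

theorem AffineMap.mem_fixedSubspace {g : P →ᵃ[ℝ] P} {x : P} :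
    x ∈ g.fixedSubspace ↔ g x = x :=
  Iff.rfl

theorem AffineIsometryEquiv.midpoint_mem_fixedSubspace (g : P ≃ᵃⁱ[ℝ] P)
    (hinv : Function.Involutive g) (x : P) :
    midpoint ℝ x (g x) ∈ (g.toAffineEquiv : P →ᵃ[ℝ] P).fixedSubspace := by
  rw [AffineMap.mem_fixedSubspace, AffineMap.map_midpoint]
  change midpoint ℝ (g x) (g (g x)) = _
  rw [hinv x, midpoint_comm]

/-- An involutive affine isometry is the reflection across its subspace of fixed points. -/
theorem AffineIsometryEquiv.eq_reflection_fixedSubspace (g : P ≃ᵃⁱ[ℝ] P)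
    (hinv : Function.Involutive g)
    [Nonempty (g.toAffineEquiv : P →ᵃ[ℝ] P).fixedSubspace]
    [(g.toAffineEquiv : P →ᵃ[ℝ] P).fixedSubspace.direction.HasOrthogonalProjection] (x : P) :
    g x = EuclideanGeometry.reflection (g.toAffineEquiv : P →ᵃ[ℝ] P).fixedSubspace x := by
  have hm := g.midpoint_mem_fixedSubspace hinv x
  have hdist : ∀ y ∈ (g.toAffineEquiv : P →ᵃ[ℝ] P).fixedSubspace, dist y x = dist y (g x) := by
    intro y hy
    have hy' : g y = y := hy
    conv_rhs => rw [← hy']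
    exact (g.dist_map y x).symm
  have horth : x -ᵥ midpoint ℝ x (g x) ∈
      (g.toAffineEquiv : P →ᵃ[ℝ] P).fixedSubspace.directionᗮ := by
    rw [Submodule.mem_orthogonal]
    intro v hv
    have hy := AffineSubspace.vadd_mem_of_mem_direction hv hm
    have h := AffineSubspace.mem_perpBisector_iff_inner_eq_zero.1
      (AffineSubspace.mem_perpBisector_iff_dist_eq.2 (hdist _ hy))
    rw [_root_.vadd_vsub] at h
    rw [left_vsub_midpoint, inner_smul_right, ← neg_vsub_eq_vsub_rev, inner_neg_right, h]
    simp
  have h := EuclideanGeometry.reflection_orthogonal_vadd hm horth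
  rw [vsub_vadd] at h
  rw [h, neg_vsub_eq_vsub_rev, midpoint_vsub_left, ← right_vsub_midpoint, vsub_vadd]

end

/-- Every order-2 isometry of the Euclidean plane is the reflection across a
nonempty proper affine subspace (i.e. a point or a line). -/
theorem order_two_isometry_is_reflection
    (f : Plane → Plane) (hf : Isometry f)
    (h2 : f ∘ f = id) (hne : f ≠ id) :
    ∃ s : AffineSubspace ℝ Plane,
      (s : Set Plane).Nonempty ∧ s ≠ ⊤ ∧ f = reflAcross s := by
  have hinv : Function.Involutive f := congrFun h2
  let g := Isometry.toAffineIsometryEquivOfInvolutive f hf hinv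
  have hs : ((g.toAffineEquiv : Plane →ᵃ[ℝ] Plane).fixedSubspace : Set Plane).Nonempty :=
    ⟨_, g.midpoint_mem_fixedSubspace hinv 0⟩
  refine ⟨(g.toAffineEquiv : Plane →ᵃ[ℝ] Plane).fixedSubspace, hs, fun htop => hne ?_, ?_⟩
  · funext x
    have hx : x ∈ (g.toAffineEquiv : Plane →ᵃ[ℝ] Plane).fixedSubspace :=
      htop ▸ AffineSubspace.mem_top ℝ Plane x
    exact hx
  · have := hs.to_subtype
    funext x
    rw [reflAcross, dif_pos hs]
    exact g.eq_reflection_fixedSubspace hinv x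
end
end

section
/- Let l be a line in the Euclidean plane EuclideanSpace ℝ (Fin 2) and let p be a point of the plane. The reflection across l and the point reflection at p commute if and only if p lies on l. -/
noncomputable section

/-- The point reflection at `p`, sending `x` to `2p - x`. -/
def ptRefl (p : Plane) : Plane → Plane := fun x => (2 : ℝ) • p - x

/-- `l` is a line: a nonempty affine subspace of the plane whose direction
is 1-dimensional. -/
def IsLine (l : AffineSubspace ℝ Plane) : Prop :=
  (l : Set Plane).Nonempty ∧ Module.finrank ℝ l.direction = 1

theorem reflAcross_eq_reflection (s : AffineSubspace ℝ Plane) [Nonempty s] :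
    reflAcross s = EuclideanGeometry.reflection s :=
  dif_pos (Set.nonempty_coe_sort.mp inferInstance)

/-- An affine isometry of the plane commutes with the point reflection at `p` if and only if
it fixes `p`. -/
theorem affineIsometryEquiv_comp_ptRefl_iff (f : Plane ≃ᵃⁱ[ℝ] Plane) (p : Plane) :
    f ∘ ptRefl p = ptRefl p ∘ f ↔ f p = p := by
  constructor
  · intro h
    have hp := congrFun h p
    simp only [Function.comp_apply, ptRefl, two_smul, add_sub_cancel_right] at hp
    have h2 : (2 : ℝ) • f p = (2 : ℝ) • p := by
      rw [two_smul, two_smul]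
      exact eq_sub_iff_add_eq.mp hp
    exact smul_right_injective Plane (two_ne_zero (α := ℝ)) h2
  · intro h
    funext x
    have hx := f.map_vsub x p
    have hy := f.map_vadd p (-(x - p))
    simp only [vsub_eq_sub, vadd_eq_add, map_neg, h] at hx hy
    rw [hx] at hy
    simp only [Function.comp_apply, ptRefl, two_smul]
    convert hy using 1
    · congr 1
      abel
    · abel

/-- The reflection across a line `l` and the point reflection at `p` commute
if and only if `p` lies on `l`. -/
theorem line_reflection_commutes_with_point_reflection_iff_mem
    (l : AffineSubspace ℝ Plane) (hl : IsLine l) (p : Plane) :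
    reflAcross l ∘ ptRefl p = ptRefl p ∘ reflAcross l ↔ p ∈ l := by
  have : Nonempty l := hl.1.to_subtype
  rw [reflAcross_eq_reflection, affineIsometryEquiv_comp_ptRefl_iff,
    EuclideanGeometry.reflection_eq_self_iff]
end
end

section
/- Let l be a line in the Euclidean plane EuclideanSpace ℝ (Fin 2) and let p be a point not lying on l. Then the composition of the reflection across l with the point reflection at p has infinite order in the isometry group of the plane. -/
noncomputable section

/-- Reflecting first in `q + v` and then across a subspace through `q` orthogonal to `v`
translates the line `q + ℝ v` by `-2 v`. -/
theorem reflAcross_ptRefl_add_smul {s : AffineSubspace ℝ Plane} {q v : Plane} (hq : q ∈ s)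
    (hv : v ∈ s.directionᗮ) (t : ℝ) :
    reflAcross s (ptRefl (q + v) (q + t • v)) = q + (t - 2) • v := by
  have hs : (s : Set Plane).Nonempty := ⟨q, hq⟩
  have : Nonempty s := hs.to_subtype
  have hpt : ptRefl (q + v) (q + t • v) = (2 - t) • v +ᵥ q := by
    simp only [ptRefl, vadd_eq_add]
    module
  have hw : (2 - t) • v ∈ s.directionᗮ := Submodule.smul_mem _ _ hv
  rw [hpt, reflAcross, dif_pos hs, EuclideanGeometry.reflection_orthogonal_vadd hq hw, vadd_eq_add]
  module

theorem iterate_reflAcross_comp_ptRefl {s : AffineSubspace ℝ Plane} {q v : Plane} (hq : q ∈ s)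
    (hv : v ∈ s.directionᗮ) (n : ℕ) :
    (reflAcross s ∘ ptRefl (q + v))^[n] q = q + (-2 * n : ℝ) • v := by
  induction n with
  | zero => simp
  | succ n ih =>
    rw [Function.iterate_succ_apply', ih, Function.comp_apply, reflAcross_ptRefl_add_smul hq hv]
    push_cast
    module

/-- If `p` does not lie on the line `l`, the composition of the reflection
across `l` with the point reflection at `p` has infinite order. -/
theorem comp_line_reflection_point_reflection_off_line_has_infinite_order
    (l : AffineSubspace ℝ Plane) (hl : IsLine l) (p : Plane) (hp : p ∉ l) :
    ∀ n : ℕ, 0 < n → (reflAcross l ∘ ptRefl p)^[n] ≠ id := by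
  intro n hn h
  have : Nonempty l := hl.1.to_subtype
  obtain ⟨q, hq, v, hv, rfl⟩ : ∃ q ∈ l, ∃ v ∈ l.directionᗮ, p = q + v :=
    ⟨EuclideanGeometry.orthogonalProjection l p, EuclideanGeometry.orthogonalProjection_mem p,
      p -ᵥ (EuclideanGeometry.orthogonalProjection l p : Plane),
      EuclideanGeometry.vsub_orthogonalProjection_mem_direction_orthogonal l p, by simp⟩
  have hv0 : v ≠ 0 := by
    rintro rfl
    exact hp (by simpa using hq)
  have key := iterate_reflAcross_comp_ptRefl hq hv n
  rw [h, id, left_eq_add, smul_eq_zero] at key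
  simp [hv0, hn.ne'] at key
end
end

section
/- Let l₁, l₂ be distinct parallel lines and m₁, m₂ be distinct parallel lines in the Euclidean plane EuclideanSpace ℝ (Fin 2), with l₁ perpendicular to m₁. Then there is no isometry f of the plane with f ∘ f = id and f ≠ id that commutes with all four reflections across l₁, l₂, m₁ and m₂. -/
noncomputable section

/-- A map commuting with the reflection across a nonempty affine subspace preserves that subspace. -/
theorem mem_of_comp_reflAcross_eq {s : AffineSubspace ℝ Plane} {f : Plane → Plane}
    (hf : f ∘ reflAcross s = reflAcross s ∘ f) {x : Plane} (hx : x ∈ s) : f x ∈ s := by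
  have hs : (s : Set Plane).Nonempty := ⟨x, hx⟩
  have : Nonempty s := hs.to_subtype
  have hr : reflAcross s = EuclideanGeometry.reflection s := by
    simp only [reflAcross, dif_pos hs]
  have h := congrFun hf x
  rw [hr, Function.comp_apply, Function.comp_apply,
    (EuclideanGeometry.reflection_eq_self_iff x).2 hx] at h
  exact (EuclideanGeometry.reflection_eq_self_iff _).1 h.symm

/-- A vector orthogonal to the difference of two distinct points of a line is orthogonal to the
line. -/
theorem IsLine.mem_direction_orthogonal {l : AffineSubspace ℝ Plane} (hl : IsLine l)
    {p q : Plane} (hp : p ∈ l) (hq : q ∈ l) (hpq : p ≠ q) {v : Plane}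
    (hv : inner ℝ (q - p) v = 0) : v ∈ l.directionᗮ := by
  have hd : q - p ∈ l.direction := AffineSubspace.vsub_mem_direction hq hp
  have hne : (⟨q - p, hd⟩ : l.direction) ≠ 0 := fun h ↦
    hpq (sub_eq_zero.1 (congrArg Subtype.val h)).symm
  rw [Submodule.mem_orthogonal]
  intro u hu
  obtain ⟨c, hc⟩ := (finrank_eq_one_iff_of_nonzero' _ hne).1 hl.2 ⟨u, hu⟩
  have hc' : c • (q - p) = u := congrArg Subtype.val hc
  rw [← hc', real_inner_smul_left, hv, mul_zero]

/-- Affine subspaces with orthogonal complementary directions meet. -/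
theorem exists_mem_mem_of_direction_eq_orthogonal {l m : AffineSubspace ℝ Plane}
    (hl : (l : Set Plane).Nonempty) (hm : (m : Set Plane).Nonempty)
    (h : m.direction = l.directionᗮ) : ∃ p, p ∈ l ∧ p ∈ m :=
  AffineSubspace.inter_nonempty_of_nonempty_of_sup_direction_eq_top hl hm
    (by rw [h, Submodule.sup_orthogonal_of_hasOrthogonalProjection])

/-- Affine subspaces with orthogonal complementary directions meet in at most one point. -/
theorem eq_of_mem_mem_of_direction_eq_orthogonal {l m : AffineSubspace ℝ Plane}
    (h : m.direction = l.directionᗮ) {p q : Plane} (hpl : p ∈ l) (hpm : p ∈ m)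
    (hql : q ∈ l) (hqm : q ∈ m) : p = q := by
  have hd : p - q ∈ l.direction := AffineSubspace.vsub_mem_direction hpl hql
  have hd' : p - q ∈ l.directionᗮ := h ▸ AffineSubspace.vsub_mem_direction hpm hqm
  exact sub_eq_zero.1 (inner_self_eq_zero.1 (Submodule.inner_right_of_mem_orthogonal hd hd'))

/-- An isometry fixing `p` and `q` displaces every point orthogonally to `q - p`. -/
theorem Isometry.inner_sub_sub_eq_zero {f : Plane → Plane} (hf : Isometry f) {p q : Plane}
    (hp : f p = p) (hq : f q = q) (x : Plane) : inner ℝ (q - p) (f x - x) = 0 := by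
  have h₁ := hf.dist_eq x p
  have h₂ := hf.dist_eq x q
  rw [hp] at h₁
  rw [hq] at h₂
  exact EuclideanGeometry.inner_vsub_vsub_of_dist_eq_of_dist_eq h₁.symm h₂.symm

/-- Given two distinct parallel lines `l₁, l₂` and two distinct parallel lines
`m₁, m₂` with `l₁` perpendicular to `m₁`, there is no order-2 isometry of the
plane commuting with all four reflections across these lines. -/
theorem no_order_two_isometry_commuting_with_four_reflections
    (l₁ l₂ m₁ m₂ : AffineSubspace ℝ Plane)
    (hl₁ : IsLine l₁) (hl₂ : IsLine l₂) (hm₁ : IsLine m₁) (hm₂ : IsLine m₂)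
    (hlne : l₁ ≠ l₂) (hlpar : l₁.direction = l₂.direction)
    (hmne : m₁ ≠ m₂) (hmpar : m₁.direction = m₂.direction)
    (hperp : m₁.direction = l₁.directionᗮ) :
    ¬ ∃ f : Plane → Plane, Isometry f ∧ f ∘ f = id ∧ f ≠ id ∧
        f ∘ reflAcross l₁ = reflAcross l₁ ∘ f ∧
        f ∘ reflAcross l₂ = reflAcross l₂ ∘ f ∧
        f ∘ reflAcross m₁ = reflAcross m₁ ∘ f ∧
        f ∘ reflAcross m₂ = reflAcross m₂ ∘ f := by
  rintro ⟨f, hf, -, hne, hfl₁, hfl₂, hfm₁, hfm₂⟩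
  have fix {l m : AffineSubspace ℝ Plane} (h : m.direction = l.directionᗮ)
      (hfl : f ∘ reflAcross l = reflAcross l ∘ f) (hfm : f ∘ reflAcross m = reflAcross m ∘ f)
      {p : Plane} (hpl : p ∈ l) (hpm : p ∈ m) : f p = p :=
    eq_of_mem_mem_of_direction_eq_orthogonal h (mem_of_comp_reflAcross_eq hfl hpl)
      (mem_of_comp_reflAcross_eq hfm hpm) hpl hpm
  have hperp₁₂ : m₂.direction = l₁.directionᗮ := hmpar ▸ hperp
  have hperp₂₁ : m₁.direction = l₂.directionᗮ := hlpar ▸ hperp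
  obtain ⟨p, hpl, hpm⟩ := exists_mem_mem_of_direction_eq_orthogonal hl₁.1 hm₁.1 hperp
  obtain ⟨q, hql, hqm⟩ := exists_mem_mem_of_direction_eq_orthogonal hl₁.1 hm₂.1 hperp₁₂
  obtain ⟨r, hrl, hrm⟩ := exists_mem_mem_of_direction_eq_orthogonal hl₂.1 hm₁.1 hperp₂₁
  have hp := fix hperp hfl₁ hfm₁ hpl hpm
  have hq := fix hperp₁₂ hfl₁ hfm₂ hql hqm
  have hr := fix hperp₂₁ hfl₂ hfm₁ hrl hrm
  have hpq : p ≠ q := by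
    rintro rfl
    exact hmne (AffineSubspace.ext_of_direction_eq hmpar ⟨p, hpm, hqm⟩)
  have hpr : p ≠ r := by
    rintro rfl
    exact hlne (AffineSubspace.ext_of_direction_eq hlpar ⟨p, hpl, hrl⟩)
  refine hne (funext fun x ↦ sub_eq_zero.1 ?_)
  have hl := hl₁.mem_direction_orthogonal hpl hql hpq (hf.inner_sub_sub_eq_zero hp hq x)
  have hm := hm₁.mem_direction_orthogonal hpm hrm hpr (hf.inner_sub_sub_eq_zero hp hr x)
  rw [← hperp] at hl
  exact inner_self_eq_zero.1 (Submodule.inner_right_of_mem_orthogonal hl hm)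
end
end

section
/- Let f and g be distinct isometries of the Euclidean plane EuclideanSpace ℝ (Fin 2), each of order 2 (f ∘ f = id, f ≠ id, g ∘ g = id, g ≠ id). Then f and g commute if and only if one of the following holds: (i) f and g are the reflections across two perpendicular lines, or (ii) one of f, g is the reflection across a line l and the other is the point reflection at a point p with p ∈ l. -/
noncomputable section

section InvolutiveIsometry

variable {E : Type*} [NormedAddCommGroup E] [InnerProductSpace ℝ E]

theorem LinearIsometry.eq_reflection_of_involutive [FiniteDimensional ℝ E] (A : E →ₗᵢ[ℝ] E)
    (hA : Function.Involutive A) (v : E) :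
    A v = (LinearMap.eqLocus A.toLinearMap LinearMap.id).reflection v := by
  set K := LinearMap.eqLocus A.toLinearMap LinearMap.id
  have mem_K (w : E) : w ∈ K ↔ A w = w := LinearMap.mem_eqLocus
  have hadd : v + A v ∈ K := by rw [mem_K, map_add, hA v, add_comm]
  have hsub : v - A v ∈ Kᗮ := by
    rw [Submodule.mem_orthogonal]
    intro w hw
    have h := A.inner_map_map w v
    rw [(mem_K w).1 hw] at h
    rw [inner_sub_right, h, sub_self]
  have h₁ := Submodule.reflection_mem_subspace_eq_self hadd
  have h₂ := Submodule.reflection_mem_subspace_orthogonalComplement_eq_neg hsub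
  rw [map_add] at h₁
  rw [map_sub] at h₂
  have h₃ : (2 : ℝ) • A v = (2 : ℝ) • K.reflection v := by
    rw [two_smul, two_smul]
    linear_combination (norm := module) -h₁ - h₂
  exact smul_right_injective E two_ne_zero h₃

theorem Isometry.exists_eq_reflection_of_involutive [FiniteDimensional ℝ E] {f : E → E}
    (hf : Isometry f) (hinv : Function.Involutive f) :
    ∃ (K : Submodule ℝ E) (c : E), ∀ x, f x = K.reflection (x - c) + c := by
  let e : E ≃ᵢ E := ⟨hinv.toPerm, hf⟩
  let φ : E ≃ᵃⁱ[ℝ] E := e.toRealAffineIsometryEquiv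
  have hφ (x : E) : φ x = f x := rfl
  set c := midpoint ℝ (0 : E) (f 0)
  have hc : f c = c := by
    have h := e.map_midpoint 0 (f 0)
    change f c = midpoint ℝ (f 0) (f (f 0)) at h
    rw [h, hinv 0, midpoint_comm]
  set A := φ.linearIsometryEquiv.toLinearIsometry
  have hfA (x : E) : f x = A (x - c) + c := by
    have h := φ.map_vadd c (x - c)
    simpa [hφ, hc, A] using h
  have hA : Function.Involutive A := by
    intro v
    have h := hinv (v + c)
    rw [hfA, hfA (v + c)] at h
    simpa using h
  exact ⟨_, c, fun x => by rw [hfA, A.eq_reflection_of_involutive hA]⟩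

theorem Submodule.eq_or_eq_orthogonal_of_reflection_commute {K L : Submodule ℝ E}
    [FiniteDimensional ℝ E] (hE : Module.finrank ℝ E = 2)
    (hK : Module.finrank ℝ K = 1) (hL : Module.finrank ℝ L = 1)
    (h : ∀ v, K.reflection (L.reflection v) = L.reflection (K.reflection v)) :
    L = K ∨ L = Kᗮ := by
  refine or_iff_not_imp_left.2 fun hne => ?_
  have hdisj : K ⊓ L = ⊥ := by
    by_contra hbot
    have hpos : 1 ≤ Module.finrank ℝ (K ⊓ L : Submodule ℝ E) :=
      Submodule.one_le_finrank_iff.2 hbot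
    exact hne ((Submodule.eq_of_le_of_finrank_le inf_le_right (by omega)).symm.trans
      (Submodule.eq_of_le_of_finrank_le inf_le_left (by omega)))
  have hKL : K ≤ Lᗮ := by
    intro w hw
    have hfix : L.reflection w ∈ K := by
      rw [← Submodule.reflection_eq_self_iff, h, Submodule.reflection_mem_subspace_eq_self hw]
    have hmem : w + L.reflection w ∈ K ⊓ L := by
      refine ⟨K.add_mem hw hfix, ?_⟩
      rw [SetLike.mem_coe, ← Submodule.reflection_eq_self_iff, map_add,
        Submodule.reflection_reflection, add_comm]
    rw [hdisj, Submodule.mem_bot] at hmem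
    rw [← Submodule.reflection_eq_self_iff, Submodule.reflection_orthogonal_apply]
    exact (eq_neg_of_add_eq_zero_left hmem).symm
  have hsum := L.finrank_add_finrank_orthogonal
  rw [← Submodule.orthogonal_orthogonal L,
    Submodule.eq_of_le_of_finrank_le hKL (by omega)]

end InvolutiveIsometry

theorem reflAcross_eq_of_mem {s : AffineSubspace ℝ Plane} {c : Plane} (hc : c ∈ s) (x : Plane) :
    reflAcross s x = s.direction.reflection (x - c) + c := by
  have hs : (s : Set Plane).Nonempty := ⟨c, hc⟩
  have : Nonempty s := hs.to_subtype
  rw [reflAcross, dif_pos hs]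
  have h := (EuclideanGeometry.reflection s).map_vadd c (x - c)
  rw [(EuclideanGeometry.reflection_eq_self_iff c).2 hc] at h
  rw [vadd_eq_add, sub_add_cancel, vadd_eq_add] at h
  rw [h]
  rfl

theorem isLine_mk' {K : Submodule ℝ Plane} (hK : Module.finrank ℝ K = 1) (c : Plane) :
    IsLine (AffineSubspace.mk' c K) :=
  ⟨⟨c, AffineSubspace.self_mem_mk' c K⟩, by rwa [AffineSubspace.direction_mk']⟩

theorem Isometry.eq_ptRefl_or_eq_reflAcross {f : Plane → Plane} (hf : Isometry f)
    (hinv : Function.Involutive f) (hne : f ≠ id) :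
    (∃ p, f = ptRefl p) ∨ ∃ l, IsLine l ∧ f = reflAcross l := by
  obtain ⟨K, c, hK⟩ := hf.exists_eq_reflection_of_involutive hinv
  have hle : Module.finrank ℝ K ≤ 2 := by simpa using K.finrank_le
  obtain h | h | h : Module.finrank ℝ K = 0 ∨ Module.finrank ℝ K = 1 ∨ Module.finrank ℝ K = 2 := by
    omega
  · obtain rfl := Submodule.finrank_eq_zero.1 h
    refine .inl ⟨c, funext fun x => ?_⟩
    rw [hK, Submodule.reflection_bot, ptRefl, LinearIsometryEquiv.coe_neg]
    module
  · refine .inr ⟨_, isLine_mk' h c, funext fun x => ?_⟩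
    rw [hK, reflAcross_eq_of_mem (AffineSubspace.self_mem_mk' c K)]
    congr 2
    simp only [AffineSubspace.direction_mk']
  · obtain rfl : K = ⊤ := Submodule.eq_top_of_finrank_eq (by simpa using h)
    refine absurd (funext fun x => ?_) hne
    rw [hK, Submodule.reflection_mem_subspace_eq_self Submodule.mem_top, sub_add_cancel, id]

theorem reflAcross_comp_ptRefl_comm_iff {l : AffineSubspace ℝ Plane} (hl : IsLine l) (p : Plane) :
    reflAcross l ∘ ptRefl p = ptRefl p ∘ reflAcross l ↔ p ∈ l := by
  obtain ⟨⟨c, hc⟩, -⟩ := hl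
  refine ⟨fun h => ?_, fun hp => funext fun x => ?_⟩
  · have hpp := congrFun h p
    simp only [Function.comp_apply, ptRefl, two_smul, add_sub_cancel_right] at hpp
    have hfix : reflAcross l p = p := by
      refine smul_right_injective Plane (two_ne_zero (α := ℝ)) ?_
      simp only [two_smul]
      linear_combination (norm := module) hpp
    rw [reflAcross_eq_of_mem hc, ← eq_sub_iff_add_eq, Submodule.reflection_eq_self_iff] at hfix
    exact (AffineSubspace.vsub_right_mem_direction_iff_mem hc p).1 hfix
  · simp only [Function.comp_apply, ptRefl, reflAcross_eq_of_mem hp, two_smul, map_sub, map_add]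
    abel

theorem reflAcross_comp_reflAcross_comm_iff {l₁ l₂ : AffineSubspace ℝ Plane} (h₁ : IsLine l₁)
    (h₂ : IsLine l₂) (hne : reflAcross l₁ ≠ reflAcross l₂) :
    reflAcross l₁ ∘ reflAcross l₂ = reflAcross l₂ ∘ reflAcross l₁ ↔
      l₂.direction = l₁.directionᗮ := by
  obtain ⟨⟨c, hc⟩, hl₁⟩ := h₁
  obtain ⟨⟨d, hd⟩, hl₂⟩ := h₂
  have hr₁ := reflAcross_eq_of_mem hc
  have hr₂ := reflAcross_eq_of_mem hd
  generalize l₁.direction = K at *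
  generalize l₂.direction = L at *
  constructor
  · intro h
    have hcomp (x : Plane) := congrFun h x
    simp only [Function.comp_apply, hr₁, hr₂, map_sub, map_add] at hcomp
    have hlin (v : Plane) : K.reflection (L.reflection v) = L.reflection (K.reflection v) := by
      have h₀ := hcomp 0
      simp only [map_zero] at h₀
      linear_combination (norm := module) hcomp v - h₀
    refine (Submodule.eq_or_eq_orthogonal_of_reflection_commute (by simp) hl₁ hl₂ hlin).resolve_left
      ?_
    rintro rfl
    refine hne (funext fun x => ?_)
    have h₀ := hcomp 0
    simp only [map_zero, Submodule.reflection_reflection] at h₀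
    rw [hr₁, hr₂, map_sub, map_sub]
    refine smul_right_injective Plane (two_ne_zero (α := ℝ)) ?_
    simp only [two_smul]
    linear_combination (norm := module) h₀
  · rintro rfl
    funext x
    simp only [Function.comp_apply, hr₁, hr₂, Submodule.reflection_orthogonal_apply, map_sub,
      map_add, map_neg, Submodule.reflection_reflection]
    abel

/-- Two distinct order-2 isometries of the plane commute if and only if they are
reflections across two perpendicular lines, or one is the reflection across a
line `l` and the other is the point reflection at a point `p ∈ l`. -/
theorem order_two_isometries_commute_iff
    (f g : Plane → Plane) (hf : Isometry f) (hg : Isometry g)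
    (hf2 : f ∘ f = id) (hfne : f ≠ id)
    (hg2 : g ∘ g = id) (hgne : g ≠ id)
    (hfg : f ≠ g) :
    f ∘ g = g ∘ f ↔
      ((∃ l₁ l₂ : AffineSubspace ℝ Plane, IsLine l₁ ∧ IsLine l₂ ∧
          l₂.direction = l₁.directionᗮ ∧
          f = reflAcross l₁ ∧ g = reflAcross l₂) ∨
        (∃ (l : AffineSubspace ℝ Plane) (p : Plane), IsLine l ∧ p ∈ l ∧
          ((f = reflAcross l ∧ g = ptRefl p) ∨
           (g = reflAcross l ∧ f = ptRefl p)))) := by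
  constructor
  · intro h
    obtain ⟨p, rfl⟩ | ⟨l₁, hl₁, rfl⟩ := hf.eq_ptRefl_or_eq_reflAcross (congrFun hf2) hfne <;>
    obtain ⟨q, rfl⟩ | ⟨l₂, hl₂, rfl⟩ := hg.eq_ptRefl_or_eq_reflAcross (congrFun hg2) hgne
    · refine absurd (congrArg ptRefl (?_ : p = q)) hfg
      have h₀ := congrFun h 0
      simp only [Function.comp_apply, ptRefl, sub_zero] at h₀
      have h₄ : (4 : ℝ) • p = (4 : ℝ) • q := by
        linear_combination (norm := module) h₀
      exact smul_right_injective Plane four_ne_zero h₄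
    · exact .inr ⟨l₂, p, hl₂, (reflAcross_comp_ptRefl_comm_iff hl₂ p).1 h.symm, .inr ⟨rfl, rfl⟩⟩
    · exact .inr ⟨l₁, q, hl₁, (reflAcross_comp_ptRefl_comm_iff hl₁ q).1 h, .inl ⟨rfl, rfl⟩⟩
    · exact .inl ⟨l₁, l₂, hl₁, hl₂, (reflAcross_comp_reflAcross_comm_iff hl₁ hl₂ hfg).1 h, rfl, rfl⟩
  · rintro (⟨l₁, l₂, hl₁, hl₂, hperp, rfl, rfl⟩ |
      ⟨l, p, hl, hp, ⟨rfl, rfl⟩ | ⟨rfl, rfl⟩⟩)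
    · exact (reflAcross_comp_reflAcross_comm_iff hl₁ hl₂ hfg).2 hperp
    · exact (reflAcross_comp_ptRefl_comm_iff hl p).2 hp
    · exact ((reflAcross_comp_ptRefl_comm_iff hl p).2 hp).symm
end
end
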